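/- arXiv:2510.22427 — 2 statements merged into one kernel-verified Lean document; each statement's English description precedes it below -/
import Mathlib

section
/- Let g be a Lie algebra over a field of characteristic zero and let R : g → g be a linear map satisfying the modified classical Yang–Baxter equation with some constant c, i.e., [R X, R Y] − R([R X, Y] + [X, R Y]) = −c·[X, Y] for all X, Y ∈ g. Then the R-bracket [X,Y]_R := (1/2)([R X, Y] + [X, R Y]) satisfies the Jacobi identity: [[X,Y]_R, Z]_R + [[Z,X]_R, Y]_R + [[Y,Z]_R, X]_R = 0 for all X, Y, Z ∈ g, so [·,·]_R defines a Lie algebra structure g_R on the underlying vector space of g. -/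
theorem lie_lie_cyclic_sum {L : Type*} [LieRing L] (x y z : L) :
    ⁅⁅x, y⁆, z⁆ + ⁅⁅z, x⁆, y⁆ + ⁅⁅y, z⁆, x⁆ = 0 := by
  rw [← lie_skew ⁅x, y⁆ z, ← lie_skew ⁅z, x⁆ y, ← lie_skew ⁅y, z⁆ x]
  rw [← neg_add, ← neg_add, neg_eq_zero, ← lie_jacobi x y z]
  abel

/-- If `R : g → g` satisfies the modified classical Yang–Baxter
equation with constant `c`, then the R-bracket
`[X,Y]_R = (1/2)([RX,Y] + [X,RY])` satisfies the Jacobi identity. -/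
theorem stmt2 {K L : Type*} [Field K] [CharZero K] [LieRing L] [LieAlgebra K L]
    (R : L →ₗ[K] L) (c : K)
    (hmcybe : ∀ X Y : L, ⁅R X, R Y⁆ - R (⁅R X, Y⁆ + ⁅X, R Y⁆) = -(c • ⁅X, Y⁆))
    (bR : L → L → L)
    (hbR : ∀ X Y, bR X Y = (1/2 : K) • (⁅R X, Y⁆ + ⁅X, R Y⁆)) :
    ∀ X Y Z : L, bR (bR X Y) Z + bR (bR Z X) Y + bR (bR Y Z) X = 0 := by
  intro X Y Z
  have hR (X Y : L) : R (⁅R X, Y⁆ + ⁅X, R Y⁆) = ⁅R X, R Y⁆ + c • ⁅X, Y⁆ := by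
    rw [sub_eq_iff_eq_add.mp (hmcybe X Y)]
    abel
  have hB (X Y Z : L) : bR (bR X Y) Z = (1 / 2 * (1 / 2) : K) •
      (⁅⁅R X, R Y⁆, Z⁆ + c • ⁅⁅X, Y⁆, Z⁆ + (⁅⁅R X, Y⁆, R Z⁆ + ⁅⁅X, R Y⁆, R Z⁆)) := by
    rw [hbR (bR X Y), hbR X Y, map_smul, hR, smul_lie, smul_lie, ← smul_add, smul_smul,
      add_lie, add_lie, smul_lie]
  rw [hB, hB, hB, ← smul_add, ← smul_add]
  have h₁ := lie_lie_cyclic_sum (R X) (R Y) Z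
  have h₂ := lie_lie_cyclic_sum (R X) Y (R Z)
  have h₃ := lie_lie_cyclic_sum X (R Y) (R Z)
  have h₄ := congrArg (c • ·) (lie_lie_cyclic_sum X Y Z)
  simp only [smul_add, smul_zero] at h₄
  refine (congrArg _ ?_).trans (smul_zero _)
  have h := congrArg₂ (· + ·) (congrArg₂ (· + ·) h₁ h₂) (congrArg₂ (· + ·) h₃ h₄)
  simp only [add_zero] at h
  rw [← h]
  abel
end

section
/- Let g be a finite-dimensional Lie algebra over a field of characteristic zero, and let [·,·]_* be a Lie bracket on the dual space g*. Define ad*_X ξ ∈ g* by ⟨ad*_X ξ, Y⟩ = −⟨ξ, [X,Y]⟩ and ad*_ξ X ∈ g by ⟨η, ad*_ξ X⟩ = −⟨[ξ,η]_*, X⟩ (using the canonical isomorphism g ≅ g**). Assume the Lie bialgebra compatibility condition: for all ξ, η ∈ g* and X, Y ∈ g, ⟨[ξ,η]_*, [X,Y]⟩ + ⟨ad*_X ξ, ad*_η Y⟩ − ⟨ad*_X η, ad*_ξ Y⟩ − ⟨ad*_Y ξ, ad*_η X⟩ + ⟨ad*_Y η, ad*_ξ X⟩ = 0. Then the bracket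 on d = g ⊕ g* defined by [(X,ξ),(Y,η)]_d := ([X,Y] + ad*_ξ Y − ad*_η X, [ξ,η]_* + ad*_X η − ad*_Y ξ) is antisymmetric and satisfies the Jacobi identity, so it makes d a Lie algebra (the double) containing g and g* as Lie subalgebras; moreover the natural symmetric bilinear form ⟨(X,ξ) | (Y,η)⟩ := ξ(Y) + η(X) on d is invariant: ⟨[u,v]_d | w⟩ + ⟨v | [u,w]_d⟩ = 0 for all u, v, w ∈ d. -/
/-- The coadjoint action of `X ∈ g` on `ξ ∈ g*`: `⟨ad*_X ξ, Y⟩ = −⟨ξ, [X,Y]⟩`. -/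
def coad {K L : Type*} [Field K] [LieRing L] [LieAlgebra K L]
    (X : L) (ξ : Module.Dual K L) : Module.Dual K L :=
  -(ξ ∘ₗ LieAlgebra.ad K L X)

section Coadjoint

variable {K L : Type*} [Field K] [LieRing L] [LieAlgebra K L]

lemma coad_apply (X : L) (ξ : Module.Dual K L) (Y : L) : coad X ξ Y = -ξ ⁅X, Y⁆ := rfl

lemma coad_add_left (X Y : L) (ξ : Module.Dual K L) :
    coad (X + Y) ξ = coad X ξ + coad Y ξ := by
  ext Z
  simp only [coad_apply, add_lie, map_add, LinearMap.add_apply]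
  ring

lemma coad_sub_left (X Y : L) (ξ : Module.Dual K L) :
    coad (X - Y) ξ = coad X ξ - coad Y ξ := by
  ext Z
  simp only [coad_apply, sub_lie, map_sub, LinearMap.sub_apply]
  ring

lemma coad_zero_right (X : L) : coad X (0 : Module.Dual K L) = 0 := by
  ext Z
  simp [coad_apply]

lemma coad_zero_left (ξ : Module.Dual K L) : coad (0 : L) ξ = 0 := by
  ext Z
  simp [coad_apply]

lemma apply_lie_eq_coad (X Y : L) (ξ : Module.Dual K L) : ξ ⁅X, Y⁆ = coad Y ξ X := by
  rw [coad_apply, ← lie_skew, map_neg]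

lemma apply_lie_jacobi (ξ : Module.Dual K L) (X Y Z : L) :
    ξ ⁅⁅X, Y⁆, Z⁆ + ξ ⁅⁅Y, Z⁆, X⁆ + ξ ⁅⁅Z, X⁆, Y⁆ = 0 := by
  have h := congrArg ξ (lie_jacobi X Y Z)
  simp only [map_add, map_zero] at h
  rw [← lie_skew X ⁅Y, Z⁆, ← lie_skew Y ⁅Z, X⁆, ← lie_skew Z ⁅X, Y⁆] at h
  simp only [map_neg] at h
  linear_combination -h

end Coadjoint

/-- Let `g` be a finite-dimensional Lie algebra and `[·,·]_*` a
Lie bracket on `g*` satisfying the Lie bialgebra compatibility condition, with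
`ad*_X ξ ∈ g*` defined by `⟨ad*_X ξ, Y⟩ = −⟨ξ, [X,Y]⟩` and `ad*_ξ X ∈ g` the
element `A ξ X` defined by `⟨η, A ξ X⟩ = −⟨[ξ,η]_*, X⟩`. Then the bracket on
`d = g ⊕ g*` given by
`[(X,ξ),(Y,η)]_d = ([X,Y] + ad*_ξ Y − ad*_η X, [ξ,η]_* + ad*_X η − ad*_Y ξ)`
is antisymmetric, satisfies the Jacobi identity, makes `g` and `g*` Lie
subalgebras of the double `d`, and the natural symmetric bilinear form
`⟨(X,ξ)|(Y,η)⟩ = ξ(Y) + η(X)` is invariant. -/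
theorem stmt18 {K L : Type*} [Field K] [CharZero K] [LieRing L] [LieAlgebra K L]
    [FiniteDimensional K L]
    (bstar : Module.Dual K L →ₗ[K] Module.Dual K L →ₗ[K] Module.Dual K L)
    (hanti : ∀ ξ η : Module.Dual K L, bstar ξ η = -bstar η ξ)
    (hjac : ∀ ξ η ζ : Module.Dual K L,
      bstar (bstar ξ η) ζ + bstar (bstar η ζ) ξ + bstar (bstar ζ ξ) η = 0)
    (A : Module.Dual K L → L → L)
    (hA : ∀ (ξ : Module.Dual K L) (X : L) (η : Module.Dual K L),
      η (A ξ X) = -((bstar ξ η) X))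
    (hcompat : ∀ (ξ η : Module.Dual K L) (X Y : L),
      (bstar ξ η) ⁅X, Y⁆ + (coad X ξ) (A η Y) - (coad X η) (A ξ Y)
        - (coad Y ξ) (A η X) + (coad Y η) (A ξ X) = 0)
    (bd : L × Module.Dual K L → L × Module.Dual K L → L × Module.Dual K L)
    (hbd : ∀ u v : L × Module.Dual K L,
      bd u v = (⁅u.1, v.1⁆ + A u.2 v.1 - A v.2 u.1,
                bstar u.2 v.2 + coad u.1 v.2 - coad v.1 u.2))
    (F : L × Module.Dual K L → L × Module.Dual K L → K)
    (hF : ∀ u v : L × Module.Dual K L, F u v = u.2 v.1 + v.2 u.1) :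
    (∀ u v : L × Module.Dual K L, bd u v = -bd v u) ∧
    (∀ u v w : L × Module.Dual K L,
      bd (bd u v) w + bd (bd v w) u + bd (bd w u) v = 0) ∧
    (∀ X Y : L, bd (X, 0) (Y, 0) = (⁅X, Y⁆, 0)) ∧
    (∀ ξ η : Module.Dual K L, bd (0, ξ) (0, η) = ((0 : L), bstar ξ η)) ∧
    (∀ u v w : L × Module.Dual K L, F (bd u v) w + F v (bd u w) = 0) := by
  have ext_dual : ∀ X Y : L, (∀ η : Module.Dual K L, η X = η Y) → X = Y := fun X Y h =>
    Module.forall_dual_apply_eq_zero_iff K (X - Y) |>.mp (fun η => by simp [h η]) |> sub_eq_zero.mp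
  have hA_zero_left : ∀ X : L, A 0 X = 0 := fun X => ext_dual _ _ fun η => by simp [hA]
  have hA_zero_right : ∀ ξ, A ξ 0 = 0 := fun ξ => ext_dual _ _ fun η => by simp [hA]
  have hanti' : ∀ ξ η (X : L), bstar ξ η X = -bstar η ξ X := fun ξ η X => by
    rw [hanti, LinearMap.neg_apply]
  have hjac' : ∀ ξ η ζ (X : L), bstar (bstar ξ η) ζ X + bstar (bstar η ζ) ξ X
      + bstar (bstar ζ ξ) η X = 0 := fun ξ η ζ X => by
    simpa using LinearMap.congr_fun (hjac ξ η ζ) X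
  have hcocycle : ∀ (ξ η : Module.Dual K L) (X Y : L),
      bstar ξ η ⁅X, Y⁆ - bstar η (coad X ξ) Y + bstar ξ (coad X η) Y
        + bstar η (coad Y ξ) X - bstar ξ (coad Y η) X = 0 := fun ξ η X Y => by
    have h := hcompat ξ η X Y
    simp only [hA] at h
    linear_combination h
  refine ⟨?_, ?_, ?_, ?_, ?_⟩
  · rintro ⟨X, ξ⟩ ⟨Y, η⟩
    simp only [hbd, Prod.neg_mk, Prod.mk.injEq]
    constructor
    · rw [← lie_skew]
      abel
    · rw [hanti]
      abel
  · rintro ⟨X, ξ⟩ ⟨Y, η⟩ ⟨Z, ζ⟩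
    simp only [hbd, Prod.mk_add_mk, Prod.mk_eq_zero]
    constructor
    · refine ext_dual _ _ fun τ => ?_
      have key : ∀ (X Y Z : L) (ξ η ζ : Module.Dual K L),
          τ (⁅⁅X, Y⁆ + A ξ Y - A η X, Z⁆ + A (bstar ξ η + coad X η - coad Y ξ) Z
            - A ζ (⁅X, Y⁆ + A ξ Y - A η X)) =
          τ ⁅⁅X, Y⁆, Z⁆ - bstar ξ (coad Z τ) Y + bstar η (coad Z τ) X
            - bstar (bstar ξ η) τ Z + bstar τ (coad X η) Z - bstar τ (coad Y ξ) Z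
            + bstar ζ τ ⁅X, Y⁆ + bstar (bstar ζ τ) ξ Y - bstar (bstar ζ τ) η X := by
        intro X Y Z ξ η ζ
        simp only [add_lie, sub_lie, map_add, map_sub, hA, LinearMap.add_apply,
          LinearMap.sub_apply, apply_lie_eq_coad (A _ _)]
        rw [hanti' (coad X η), hanti' (coad Y ξ), hanti' ξ (bstar ζ τ),
          hanti' η (bstar ζ τ)]
        ring
      have hswap : ∀ ξ η (X : L), bstar (bstar τ ξ) η X = -bstar (bstar ξ τ) η X :=
        fun ξ η X => by rw [hanti τ ξ, map_neg, LinearMap.neg_apply, LinearMap.neg_apply]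
      rw [map_add, map_add, key, key, key, map_zero]
      linear_combination apply_lie_jacobi τ X Y Z + hcocycle ζ τ X Y + hcocycle ξ τ Y Z
        + hcocycle η τ Z X - hjac' ξ η τ Z - hjac' η ζ τ X - hjac' ζ ξ τ Y
        + hswap ξ η Z + hswap η ζ X + hswap ζ ξ Y
    · ext T
      have key : ∀ (X Y Z : L) (ξ η ζ : Module.Dual K L),
          (bstar (bstar ξ η + coad X η - coad Y ξ) ζ + coad (⁅X, Y⁆ + A ξ Y - A η X) ζ
            - coad Z (bstar ξ η + coad X η - coad Y ξ)) T =
          bstar (bstar ξ η) ζ T - bstar ζ (coad X η) T + bstar ζ (coad Y ξ) T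
            - ζ ⁅⁅X, Y⁆, T⁆ + bstar ξ (coad T ζ) Y - bstar η (coad T ζ) X
            + bstar ξ η ⁅Z, T⁆ - η ⁅X, ⁅Z, T⁆⁆ + ξ ⁅Y, ⁅Z, T⁆⁆ := by
        intro X Y Z ξ η ζ
        simp only [coad_add_left, coad_sub_left, map_add, map_sub, LinearMap.add_apply,
          LinearMap.sub_apply, coad_apply Z, coad_apply ⁅X, Y⁆, coad_apply (A _ _),
          apply_lie_eq_coad (A _ _), hA]
        rw [hanti' (coad X η), hanti' (coad Y ξ), coad_apply X, coad_apply Y]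
        ring
      have hlie : ∀ (ζ : Module.Dual K L) (X Y : L),
          ζ ⁅⁅X, Y⁆, T⁆ = ζ ⁅X, ⁅Y, T⁆⁆ - ζ ⁅Y, ⁅X, T⁆⁆ := fun ζ X Y => by
        rw [lie_lie, map_sub]
      rw [LinearMap.add_apply, LinearMap.add_apply, key, key, key, LinearMap.zero_apply]
      linear_combination hjac' ξ η ζ T + hcocycle ξ η Z T + hcocycle η ζ X T
        + hcocycle ζ ξ Y T - hlie ζ X Y - hlie ξ Y Z - hlie η Z X
  · intro X Y
    simp [hbd, hA_zero_left, coad_zero_right]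
  · intro ξ η
    simp [hbd, hA_zero_right, coad_zero_left]
  · rintro ⟨X, ξ⟩ ⟨Y, η⟩ ⟨Z, ζ⟩
    simp only [hbd, hF, LinearMap.add_apply, LinearMap.sub_apply, map_add, map_sub, hA,
      coad_apply]
    rw [← lie_skew Z Y, hanti' ζ η]
    simp only [map_neg]
    ring
end
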